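/- For every n ≥ 1 and every Z in the unital subalgebra of End(V^{⊗n}) generated by R₁, …, R_{n−1}, the element ch_n(Z) := Tr_{R(1…n)}(Z · M_{⟨1→n⟩}) of A equals Tr_{R(1…n)}(M_{⟨1→n⟩} · Z) and commutes with every entry of the matrix M (hence with every element of the subalgebra of A generated by the entries of M). -/

import Mathlib

open scoped BigOperators

noncomputable section

/-- One-site embedding of an `N×N` matrix into `Mat_{N^k}` at 0-based position `i`
(the paper's `X_{i+1}` in 1-based numbering).  Out of range we return the identity. -/
def matAt {α : Type*} [Semiring α] (N k : ℕ) (X : Matrix (Fin N) (Fin N) α) (i : ℕ) :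
    Matrix (Fin k → Fin N) (Fin k → Fin N) α :=
  if h : i < k then
    Matrix.of fun a b =>
      if ∀ l : Fin k, (l : ℕ) ≠ i → a l = b l then X (a ⟨i, h⟩) (b ⟨i, h⟩) else 0
  else 1

/-- Two-site embedding of an operator on `V⊗V` into `Mat_{N^k}` at 0-based positions
`i, i+1` (the paper's `R_{i+1}` in 1-based numbering). -/
def opAt {α : Type*} [Semiring α] (N k : ℕ)
    (R : Matrix (Fin N × Fin N) (Fin N × Fin N) α) (i : ℕ) :
    Matrix (Fin k → Fin N) (Fin k → Fin N) α :=
  if h : i + 1 < k then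
    Matrix.of fun a b =>
      if ∀ l : Fin k, (l : ℕ) ≠ i → (l : ℕ) ≠ i + 1 → a l = b l then
        R (a ⟨i, by omega⟩, a ⟨i + 1, h⟩) (b ⟨i, by omega⟩, b ⟨i + 1, h⟩)
      else 0
  else 1

/-- A numeric (complex) matrix viewed inside `Mat(A)` via the unit of `A`. -/
def toA (A : Type*) [Semiring A] [Algebra ℂ A] {ι : Type*} (X : Matrix ι ι ℂ) :
    Matrix ι ι A :=
  X.map (algebraMap ℂ A)

/-- The braid relation `R₁R₂R₁ = R₂R₁R₂` on `V^{⊗3}`. -/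
def IsBraid (N : ℕ) (R : Matrix (Fin N × Fin N) (Fin N × Fin N) ℂ) : Prop :=
  opAt N 3 R 0 * opAt N 3 R 1 * opAt N 3 R 0 = opAt N 3 R 1 * opAt N 3 R 0 * opAt N 3 R 1

/-- The Hecke condition `(q·I − R)(q⁻¹·I + R) = 0`. -/
def IsHecke (N : ℕ) (q : ℂ) (R : Matrix (Fin N × Fin N) (Fin N × Fin N) ℂ) : Prop :=
  (q • (1 : Matrix (Fin N × Fin N) (Fin N × Fin N) ℂ) - R) * (q⁻¹ • 1 + R) = 0

/-- `q` is generic: `q ∉ {0, 1, −1}` and `qⁿ ≠ 1` for all positive integers `n`. -/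
def GenericQ (q : ℂ) : Prop :=
  q ≠ 0 ∧ q ≠ 1 ∧ q ≠ -1 ∧ ∀ n : ℕ, 0 < n → q ^ n ≠ 1

/-- The reflection-equation type relation `R X₁ R X₁ = X₁ R X₁ R` in `Mat_{N²}`. -/
def RErel {α : Type*} [Semiring α] (N : ℕ)
    (R : Matrix (Fin N × Fin N) (Fin N × Fin N) α) (X : Matrix (Fin N) (Fin N) α) : Prop :=
  opAt N 2 R 0 * matAt N 2 X 0 * opAt N 2 R 0 * matAt N 2 X 0 =
    matAt N 2 X 0 * opAt N 2 R 0 * matAt N 2 X 0 * opAt N 2 R 0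

/-- The quantum-double permutation relation `D₁ R M₁ R = R M₁ R⁻¹ D₁ + R` in `Mat_{N²}(A)`. -/
def PermRel {A : Type*} [Ring A] [Algebra ℂ A] (N : ℕ)
    (R Rinv : Matrix (Fin N × Fin N) (Fin N × Fin N) ℂ)
    (M D : Matrix (Fin N) (Fin N) A) : Prop :=
  matAt N 2 D 0 * opAt N 2 (toA A R) 0 * matAt N 2 M 0 * opAt N 2 (toA A R) 0 =
    opAt N 2 (toA A R) 0 * matAt N 2 M 0 * opAt N 2 (toA A Rinv) 0 * matAt N 2 D 0 +
      opAt N 2 (toA A R) 0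

/-- The homogeneous permutation relation `D₁ R M₁ R = R M₁ R⁻¹ D₁` in `Mat_{N²}(A)`. -/
def PermRelHom {A : Type*} [Ring A] [Algebra ℂ A] (N : ℕ)
    (R Rinv : Matrix (Fin N × Fin N) (Fin N × Fin N) ℂ)
    (M D : Matrix (Fin N) (Fin N) A) : Prop :=
  matAt N 2 D 0 * opAt N 2 (toA A R) 0 * matAt N 2 M 0 * opAt N 2 (toA A R) 0 =
    opAt N 2 (toA A R) 0 * matAt N 2 M 0 * opAt N 2 (toA A Rinv) 0 * matAt N 2 D 0

/-- Overline copies: `ovCopy … r = X_{⟨r+1⟩}`, i.e. `X_{⟨1⟩} = X⊗I⊗⋯⊗I` and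
`X_{⟨r+1⟩} = R_r X_{⟨r⟩} R_r⁻¹`. -/
def ovCopy {α : Type*} [Semiring α] (N k : ℕ)
    (R Rinv : Matrix (Fin N × Fin N) (Fin N × Fin N) α)
    (X : Matrix (Fin N) (Fin N) α) : ℕ → Matrix (Fin k → Fin N) (Fin k → Fin N) α
  | 0 => matAt N k X 0
  | r + 1 => opAt N k R r * ovCopy N k R Rinv X r * opAt N k Rinv r

/-- Underline copies: `unCopy … r = X_{[r+1]}`, i.e. `X_{[1]} = X⊗I⊗⋯⊗I` and
`X_{[r+1]} = R_r⁻¹ X_{[r]} R_r`. -/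
def unCopy {α : Type*} [Semiring α] (N k : ℕ)
    (R Rinv : Matrix (Fin N × Fin N) (Fin N × Fin N) α)
    (X : Matrix (Fin N) (Fin N) α) : ℕ → Matrix (Fin k → Fin N) (Fin k → Fin N) α
  | 0 => matAt N k X 0
  | r + 1 => opAt N k Rinv r * unCopy N k R Rinv X r * opAt N k R r

/-- `X_{⟨1→n⟩} = X_{⟨1⟩}X_{⟨2⟩}⋯X_{⟨n⟩}`. -/
def ovProd {α : Type*} [Semiring α] (N k : ℕ)
    (R Rinv : Matrix (Fin N × Fin N) (Fin N × Fin N) α)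
    (X : Matrix (Fin N) (Fin N) α) (n : ℕ) : Matrix (Fin k → Fin N) (Fin k → Fin N) α :=
  ((List.range n).map (ovCopy N k R Rinv X)).prod

/-- `X_{⟨n→1⟩} = X_{⟨n⟩}X_{⟨n−1⟩}⋯X_{⟨1⟩}`. -/
def ovProdRev {α : Type*} [Semiring α] (N k : ℕ)
    (R Rinv : Matrix (Fin N × Fin N) (Fin N × Fin N) α)
    (X : Matrix (Fin N) (Fin N) α) (n : ℕ) : Matrix (Fin k → Fin N) (Fin k → Fin N) α :=
  ((List.range n).reverse.map (ovCopy N k R Rinv X)).prod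

/-- Shifted Jucys–Murphy matrices: `JMup … R n s = J_{s+1}^{↑n}`, i.e. `J₁^{↑n} = I` and
`J_{s+1}^{↑n} = R_{n+s} J_s^{↑n} R_{n+s}` (paper's 1-based `R_{n+s}` is `opAt … (n+s-1)`).
Applying it to `R⁻¹` produces `(J_{s+1}^{↑n})⁻¹`. -/
def JMup {α : Type*} [Semiring α] (N k : ℕ)
    (R : Matrix (Fin N × Fin N) (Fin N × Fin N) α) (n : ℕ) :
    ℕ → Matrix (Fin k → Fin N) (Fin k → Fin N) α
  | 0 => 1
  | s + 1 => opAt N k R (n + s) * JMup N k R n s * opAt N k R (n + s)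

/-- The quantum trace `Tr_{R(1…n)}(X) = Tr(C₁C₂⋯C_n X)`. -/
def qTr {α : Type*} [Semiring α] (N n : ℕ) (C : Matrix (Fin N) (Fin N) α)
    (X : Matrix (Fin n → Fin N) (Fin n → Fin N) α) : α :=
  Matrix.trace (((List.range n).map (matAt N n C)).prod * X)

/-- The matrix `C`, `C_i^j = Σ_k Ψ_{ik}^{jk}`. -/
def traceMat (N : ℕ) (Ψ : Matrix (Fin N × Fin N) (Fin N × Fin N) ℂ) :
    Matrix (Fin N) (Fin N) ℂ :=
  Matrix.of fun i j => ∑ k, Ψ (i, k) (j, k)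

/-- Skew-invertibility of `R`: `Tr₂(R₁₂Ψ₂₃) = Tr₂(Ψ₁₂R₂₃) = P₁₃`, written componentwise. -/
def SkewInv (N : ℕ) (R Ψ : Matrix (Fin N × Fin N) (Fin N × Fin N) ℂ) : Prop :=
  (∀ i k l n : Fin N, ∑ j, ∑ b, R (i, j) (l, b) * Ψ (b, k) (j, n) =
      if i = n ∧ k = l then 1 else 0) ∧
  (∀ i k l n : Fin N, ∑ j, ∑ b, Ψ (i, j) (l, b) * R (b, k) (j, n) =
      if i = n ∧ k = l then 1 else 0)

/-- The generators `R₁, …, R_{n−1}` (1-based) of the Hecke-algebra image inside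
`End(V^{⊗k})`, as a subset of `Mat_{N^k}`. -/
def genSet {α : Type*} [Semiring α] (N k n : ℕ)
    (R : Matrix (Fin N × Fin N) (Fin N × Fin N) α) :
    Set (Matrix (Fin k → Fin N) (Fin k → Fin N) α) :=
  {X | ∃ i : ℕ, i + 1 < n ∧ X = opAt N k R i}

/-- The left ideal of `A` generated by the entries of `D`. -/
def entryIdeal (A : Type*) [Ring A] {N : ℕ} (D : Matrix (Fin N) (Fin N) A) :
    Submodule A A :=
  Submodule.span A {x : A | ∃ i j : Fin N, x = D i j}

/-- The normally ordered monomial `:L̂_{⟨1→k⟩}: = M_{⟨1→k⟩} D_{⟨k→1⟩} ∏_{s=1}^{k} J_s⁻¹`. -/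
def normOrd {α : Type*} [Semiring α] (N k : ℕ)
    (R Rinv : Matrix (Fin N × Fin N) (Fin N × Fin N) α)
    (M D : Matrix (Fin N) (Fin N) α) (n : ℕ) :
    Matrix (Fin k → Fin N) (Fin k → Fin N) α :=
  ovProd N k R Rinv M n * ovProdRev N k R Rinv D n *
    ((List.range n).map (fun s => JMup N k Rinv 0 s)).prod

section Place

variable {α : Type*} [Semiring α] {N m k p : ℕ}

open Classical in
/-- The operator `U` on `V^{⊗m}` acting on the tensor factors of `V^{⊗k}` selected by `e`. -/
def place (e : Fin m → Fin k) (U : Matrix (Fin m → Fin N) (Fin m → Fin N) α) :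
    Matrix (Fin k → Fin N) (Fin k → Fin N) α :=
  Matrix.of fun a b => if ∀ l, l ∉ Set.range e → a l = b l then U (a ∘ e) (b ∘ e) else 0

open Classical in
theorem place_apply (e : Fin m → Fin k) (U : Matrix (Fin m → Fin N) (Fin m → Fin N) α)
    (a b : Fin k → Fin N) :
    place e U a b = if ∀ l, l ∉ Set.range e → a l = b l then U (a ∘ e) (b ∘ e) else 0 :=
  rfl

theorem place_add (e : Fin m → Fin k) (U V : Matrix (Fin m → Fin N) (Fin m → Fin N) α) :
    place e (U + V) = place e U + place e V := by
  ext a b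
  simp only [place_apply, Matrix.add_apply]
  split_ifs <;> simp

theorem place_smul {S : Type*} [SMulZeroClass S α] (s : S) (e : Fin m → Fin k)
    (U : Matrix (Fin m → Fin N) (Fin m → Fin N) α) :
    place e (s • U) = s • place e U := by
  ext a b
  simp only [place_apply, Matrix.smul_apply]
  split_ifs <;> simp

theorem place_one (e : Fin m → Fin k) :
    place e (1 : Matrix (Fin m → Fin N) (Fin m → Fin N) α) = 1 := by
  ext a b
  rw [place_apply, Matrix.one_apply, Matrix.one_apply]
  by_cases h : a = b
  · simp [h]
  · rw [if_neg h]
    split_ifs with h1 h2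
    · refine absurd (funext fun l => ?_) h
      by_cases hl : l ∈ Set.range e
      · obtain ⟨j, rfl⟩ := hl
        exact congrFun h2 j
      · exact h1 l hl
    · rfl
    · rfl

theorem place_mul {e : Fin m → Fin k} (he : Function.Injective e)
    (U V : Matrix (Fin m → Fin N) (Fin m → Fin N) α) :
    place e (U * V) = place e U * place e V := by
  classical
  ext a b
  rw [place_apply, Matrix.mul_apply (M := place e U)]
  simp only [place_apply, ite_mul, zero_mul, mul_ite, mul_zero, ← ite_and]
  split_ifs with hab
  · rw [Matrix.mul_apply, ← Finset.sum_filter]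
    refine Finset.sum_nbij' (fun d => Function.extend e d a) (fun c => c ∘ e) ?_ ?_ ?_ ?_ ?_
    · intro d _
      simp only [Finset.mem_filter, Finset.mem_univ, true_and]
      constructor
      · intro l hl
        rw [Function.extend_apply' _ _ _ (by simpa using hl)]
        exact hab l hl
      · intro l hl
        rw [Function.extend_apply' _ _ _ (by simpa using hl)]
    · simp
    · intro d _
      exact Function.extend_comp he d a
    · intro c hc
      simp only [Finset.mem_filter, Finset.mem_univ, true_and] at hc
      funext l
      by_cases hl : l ∈ Set.range e
      · obtain ⟨j, rfl⟩ := hl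
        simp [he.extend_apply]
      · rw [Function.extend_apply' _ _ _ (by simpa using hl)]
        exact hc.2 l hl
    · intro d _
      rw [Function.extend_comp he]
  · refine (Finset.sum_eq_zero fun c _ => if_neg ?_).symm
    rintro ⟨h1, h2⟩
    exact hab fun l hl => (h2 l hl).trans (h1 l hl)

open Classical in
theorem place_mul_place_apply {e : Fin m → Fin k} {f : Fin p → Fin k}
    (h : ∀ i j, e i ≠ f j)
    (U : Matrix (Fin m → Fin N) (Fin m → Fin N) α)
    (V : Matrix (Fin p → Fin N) (Fin p → Fin N) α) (a b : Fin k → Fin N) :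
    (place e U * place f V) a b =
      if ∀ l, l ∉ Set.range e → l ∉ Set.range f → a l = b l then
        U (a ∘ e) (b ∘ e) * V (a ∘ f) (b ∘ f) else 0 := by
  set c : Fin k → Fin N := fun l => if l ∈ Set.range e then b l else a l with hc
  have hef : ∀ j, f j ∉ Set.range e := fun j ⟨i, hi⟩ => h i j hi
  have hce : c ∘ e = b ∘ e := by funext j; simp [hc]
  have hcf : c ∘ f = a ∘ f := by funext j; simp only [hc, Function.comp_apply, if_neg (hef j)]
  rw [Matrix.mul_apply, Finset.sum_eq_single c]
  · rw [place_apply, place_apply, if_pos, hce, hcf]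
    · rw [mul_ite, mul_zero]
      refine if_congr ⟨fun H l h1 h2 => ?_, fun H l h2 => ?_⟩ rfl rfl
      · simpa only [hc, if_neg h1] using H l h2
      · by_cases h1 : l ∈ Set.range e
        · simp only [hc, if_pos h1]
        · simp only [hc, if_neg h1]
          exact H l h1 h2
    · intro l hl
      simp only [hc, if_neg hl]
  · intro d _ hd
    simp only [place_apply]
    split_ifs with h1 h2
    · refine absurd (funext fun l => ?_) hd
      by_cases hl : l ∈ Set.range e
      · simp only [hc, if_pos hl]
        obtain ⟨j, rfl⟩ := hl
        exact h2 _ fun ⟨i, hi⟩ => h j i hi.symm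
      · simp only [hc, if_neg hl]
        exact (h1 l hl).symm
    all_goals simp
  · simp

/-- The embedding of an interval of tensor factors, shifted by `s`. -/
def shiftEmb (m k s : ℕ) (h : m + s ≤ k) (l : Fin m) : Fin k :=
  ⟨l + s, by omega⟩

theorem shiftEmb_injective (s : ℕ) (h : m + s ≤ k) :
    Function.Injective (shiftEmb m k s h) := by
  intro x y hxy
  simpa [shiftEmb, Fin.ext_iff] using hxy

theorem mem_range_shiftEmb (s : ℕ) (h : m + s ≤ k) (l : Fin k) :
    l ∈ Set.range (shiftEmb m k s h) ↔ s ≤ l ∧ (l : ℕ) < m + s := by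
  constructor
  · rintro ⟨x, rfl⟩
    simp only [shiftEmb]
    omega
  · rintro ⟨h1, h2⟩
    exact ⟨⟨l - s, by omega⟩, Fin.ext (by simp only [shiftEmb]; omega)⟩

theorem forall_shiftEmb {s : ℕ} {h : m + s ≤ k} {P : Fin k → Prop} {Q : ℕ → Prop}
    (hQ : ∀ x, Q x → s ≤ x ∧ x < m + s) :
    ((∀ l, l ∉ Set.range (shiftEmb m k s h) → P l) ∧
      ∀ l : Fin m, ¬ Q (l + s) → P (shiftEmb m k s h l)) ↔ ∀ l : Fin k, ¬ Q l → P l := by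
  constructor
  · rintro ⟨h1, h2⟩ l hl
    by_cases hr : l ∈ Set.range (shiftEmb m k s h)
    · obtain ⟨x, rfl⟩ := hr
      exact h2 x hl
    · exact h1 l hr
  · intro H
    refine ⟨fun l hl => H l fun hq => hl ?_, fun l hl => H _ hl⟩
    exact (mem_range_shiftEmb s h l).2 (hQ _ hq)

theorem place_matAt (X : Matrix (Fin N) (Fin N) α) {i s : ℕ} (hi : i < m) (h : m + s ≤ k) :
    place (shiftEmb m k s h) (matAt N m X i) = matAt N k X (i + s) := by
  classical
  ext a b
  have key := forall_shiftEmb (h := h) (P := fun l => a l = b l) (Q := fun x => x = i + s)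
    (by intros; omega)
  rw [place_apply, matAt, matAt, dif_pos hi, dif_pos (by omega), Matrix.of_apply,
    Matrix.of_apply, ← ite_and]
  refine if_congr ?_ rfl rfl
  simp only [add_left_inj] at key
  exact key

theorem place_opAt (R : Matrix (Fin N × Fin N) (Fin N × Fin N) α) {i s : ℕ} (hi : i + 1 < m)
    (h : m + s ≤ k) :
    place (shiftEmb m k s h) (opAt N m R i) = opAt N k R (i + s) := by
  classical
  ext a b
  have key := forall_shiftEmb (h := h) (P := fun l => a l = b l)
    (Q := fun x => x = i + s ∨ x = i + s + 1) (by intros; omega)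
  rw [place_apply, opAt, opAt, dif_pos hi, dif_pos (by omega), Matrix.of_apply,
    Matrix.of_apply, ← ite_and]
  have h1 : shiftEmb m k s h ⟨i + 1, hi⟩ = ⟨i + s + 1, by omega⟩ :=
    Fin.ext (by simp only [shiftEmb]; omega)
  refine if_congr ?_ ?_ rfl
  · simp only [not_or, and_imp, show i + s + 1 = i + 1 + s by omega, add_left_inj] at key
    simp only [show i + s + 1 = i + 1 + s by omega]
    exact key
  · simp only [Function.comp_apply, h1]
    rfl

theorem opAt_one (i : ℕ) : opAt N k (1 : Matrix (Fin N × Fin N) (Fin N × Fin N) α) i = 1 := by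
  by_cases h : i + 1 < k
  · ext a b
    rw [opAt, dif_pos h, Matrix.of_apply, Matrix.one_apply, Matrix.one_apply]
    by_cases hab : a = b
    · simp [hab]
    · rw [if_neg hab]
      split_ifs with h1 h2
      · refine absurd (funext fun l => ?_) hab
        rw [Prod.mk.injEq] at h2
        by_cases hl : (l : ℕ) = i
        · have : l = ⟨i, by omega⟩ := Fin.ext hl
          rw [this]
          exact h2.1
        · by_cases hl' : (l : ℕ) = i + 1
          · have : l = ⟨i + 1, h⟩ := Fin.ext hl'
            rw [this]
            exact h2.2
          · exact h1 l hl hl'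
      · rfl
      · rfl
  · rw [opAt, dif_neg h]

theorem opAt_two_mul (R S : Matrix (Fin N × Fin N) (Fin N × Fin N) α) :
    opAt N 2 (R * S) 0 = opAt N 2 R 0 * opAt N 2 S 0 := by
  have key : ∀ (R : Matrix (Fin N × Fin N) (Fin N × Fin N) α) (a b : Fin 2 → Fin N),
      opAt N 2 R 0 a b = R (a 0, a 1) (b 0, b 1) := by
    intro R a b
    rw [opAt, dif_pos (by omega), Matrix.of_apply, if_pos (by intro l; omega)]
    rfl
  ext a b
  rw [key, Matrix.mul_apply, Matrix.mul_apply]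
  simp only [key]
  exact (Fintype.sum_equiv (finTwoArrowEquiv (Fin N)) _ _ fun c => rfl).symm

theorem opAt_mul (R S : Matrix (Fin N × Fin N) (Fin N × Fin N) α) (i : ℕ) :
    opAt N k (R * S) i = opAt N k R i * opAt N k S i := by
  by_cases h : i + 1 < k
  · have h2 : 2 + i ≤ k := by omega
    have := place_opAt (N := N) (α := α) (m := 2) (i := 0) (h := h2) (hi := by omega)
    simp only [zero_add] at this
    rw [← this, ← this, ← this, opAt_two_mul, place_mul (shiftEmb_injective i h2)]
  · simp [opAt, dif_neg h]

theorem opAt_mul_opAt_eq_one {R S : Matrix (Fin N × Fin N) (Fin N × Fin N) α}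
    (h : R * S = 1) (i : ℕ) : opAt N k R i * opAt N k S i = 1 := by
  rw [← opAt_mul, h, opAt_one]

end Place

section Scalars

variable {A : Type*} [Ring A] [Algebra ℂ A] {N k m : ℕ}

theorem opAt_toA (R : Matrix (Fin N × Fin N) (Fin N × Fin N) ℂ) (i : ℕ) :
    opAt N k (toA A R) i = toA A (opAt N k R i) := by
  ext a b
  unfold opAt toA
  split_ifs with h
  · simp only [Matrix.of_apply, Matrix.map_apply]
    split_ifs <;> simp
  · simp only [Matrix.map_apply, Matrix.one_apply]
    split_ifs <;> simp

theorem matAt_toA (X : Matrix (Fin N) (Fin N) ℂ) (i : ℕ) :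
    matAt N k (toA A X) i = toA A (matAt N k X i) := by
  ext a b
  unfold matAt toA
  split_ifs with h
  · simp only [Matrix.of_apply, Matrix.map_apply]
    split_ifs <;> simp
  · simp only [Matrix.map_apply, Matrix.one_apply]
    split_ifs <;> simp

theorem toA_mul {ι : Type*} [Fintype ι] (X Y : Matrix ι ι ℂ) :
    toA A (X * Y) = toA A X * toA A Y :=
  Matrix.map_mul

theorem toA_one {ι : Type*} [DecidableEq ι] : toA A (1 : Matrix ι ι ℂ) = 1 :=
  Matrix.map_one _ (map_zero _) (map_one _)

theorem commute_place {p : ℕ} {e : Fin m → Fin k} {f : Fin p → Fin k}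
    (h : ∀ i j, e i ≠ f j) (U : Matrix (Fin m → Fin N) (Fin m → Fin N) ℂ)
    (V : Matrix (Fin p → Fin N) (Fin p → Fin N) A) :
    Commute (place e (toA A U)) (place f V) := by
  classical
  ext a b
  rw [place_mul_place_apply h, place_mul_place_apply fun i j => (h j i).symm]
  refine if_congr ⟨fun H l h1 h2 => H l h2 h1, fun H l h1 h2 => H l h2 h1⟩ ?_ rfl
  exact Algebra.commutes _ _

theorem commute_opAt_opAt (R : Matrix (Fin N × Fin N) (Fin N × Fin N) ℂ)
    (S : Matrix (Fin N × Fin N) (Fin N × Fin N) A) {i j : ℕ} (hij : i + 1 < j ∨ j + 1 < i) :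
    Commute (opAt N k (toA A R) i) (opAt N k S j) := by
  by_cases hi : i + 1 < k
  · by_cases hj : j + 1 < k
    · have h1 := place_opAt (s := i) (toA A R) (i := 0) (by omega) (show 2 + i ≤ k by omega)
      have h2 := place_opAt (s := j) S (i := 0) (by omega) (show 2 + j ≤ k by omega)
      rw [zero_add] at h1 h2
      rw [← h1, ← h2, opAt_toA]
      refine commute_place (fun x y hxy => ?_) _ _
      simp only [shiftEmb, Fin.mk.injEq] at hxy
      omega
    · rw [opAt, opAt, dif_neg hj]
      exact Commute.one_right _
  · rw [opAt, dif_neg hi]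
    exact Commute.one_left _

theorem commute_opAt_matAt (R : Matrix (Fin N × Fin N) (Fin N × Fin N) ℂ)
    (X : Matrix (Fin N) (Fin N) A) {i j : ℕ} (hij : i + 1 < j ∨ j < i) :
    Commute (opAt N k (toA A R) i) (matAt N k X j) := by
  by_cases hi : i + 1 < k
  · by_cases hj : j < k
    · have h1 := place_opAt (s := i) (toA A R) (i := 0) (by omega) (show 2 + i ≤ k by omega)
      have h2 := place_matAt (s := j) X (i := 0) (by omega) (show 1 + j ≤ k by omega)
      rw [zero_add] at h1 h2
      rw [← h1, ← h2, opAt_toA]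
      refine commute_place (fun x y hxy => ?_) _ _
      simp only [shiftEmb, Fin.mk.injEq] at hxy
      omega
    · rw [matAt, dif_neg hj]
      exact Commute.one_right _
  · rw [opAt, dif_neg hi]
    exact Commute.one_left _

end Scalars

section PartialTrace

variable {N k : ℕ}

/-- The multi-index `a` of `V^{⊗k}` extended by the last index `i`. -/
def snocIdx (a : Fin k → Fin N) (i : Fin N) : Fin (k + 1) → Fin N :=
  Fin.snoc (α := fun _ => Fin N) a i

theorem snocIdx_of_lt (a : Fin k → Fin N) (i : Fin N) {l : ℕ} (h : l < k) (h' : l < k + 1) :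
    snocIdx a i ⟨l, h'⟩ = a ⟨l, h⟩ :=
  Fin.snoc_castSucc (α := fun _ => Fin N) i a ⟨l, h⟩

theorem snocIdx_last (a : Fin k → Fin N) (i : Fin N) (h : k < k + 1) :
    snocIdx a i ⟨k, h⟩ = i :=
  Fin.snoc_last (α := fun _ => Fin N) i a

theorem exists_eq_snocIdx (x : Fin (k + 1) → Fin N) : ∃ a i, x = snocIdx a i :=
  ⟨fun l => x l.castSucc, x (Fin.last k), (Fin.snoc_init_self (α := fun _ => Fin N) x).symm⟩

theorem snocIdx_inj {a b : Fin k → Fin N} {i j : Fin N} :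
    snocIdx a i = snocIdx b j ↔ a = b ∧ i = j := by
  refine ⟨fun h => ⟨funext fun l => ?_, ?_⟩, fun h => by rw [h.1, h.2]⟩
  · have := congrFun h ⟨l, by omega⟩
    rwa [snocIdx_of_lt _ _ l.2, snocIdx_of_lt _ _ l.2] at this
  · have := congrFun h ⟨k, by omega⟩
    rwa [snocIdx_last, snocIdx_last] at this

theorem sum_snocIdx {β : Type*} [AddCommMonoid β] (f : (Fin (k + 1) → Fin N) → β) :
    ∑ x, f x = ∑ a, ∑ i, f (snocIdx a i) := by
  rw [← Fintype.sum_prod_type']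
  refine (Fintype.sum_bijective (fun y : (Fin k → Fin N) × Fin N => snocIdx y.1 y.2)
    ⟨fun y z h => ?_, fun x => ?_⟩ _ _ fun _ => rfl).symm
  · exact Prod.ext (snocIdx_inj.1 h).1 (snocIdx_inj.1 h).2
  · obtain ⟨a, i, rfl⟩ := exists_eq_snocIdx x
    exact ⟨(a, i), rfl⟩

theorem forall_snocIdx_eq {P : ℕ → Prop} {a b : Fin k → Fin N} {i j : Fin N} :
    (∀ l : Fin (k + 1), P l → snocIdx a i l = snocIdx b j l) ↔
      (∀ l : Fin k, P l → a l = b l) ∧ (P k → i = j) := by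
  constructor
  · refine fun h => ⟨fun l hl => ?_, fun hk => ?_⟩
    · have := h ⟨l, by omega⟩ hl
      rwa [snocIdx_of_lt _ _ l.2, snocIdx_of_lt _ _ l.2] at this
    · have := h ⟨k, by omega⟩ hk
      rwa [snocIdx_last, snocIdx_last] at this
  · rintro ⟨h1, h2⟩ ⟨l, hl⟩ hP
    rcases Nat.lt_succ_iff_lt_or_eq.1 hl with h | rfl
    · simpa only [snocIdx_of_lt _ _ h] using h1 ⟨l, h⟩ hP
    · simpa only [snocIdx_last] using h2 hP

section Semiring

variable {α : Type*} [Semiring α]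

/-- The operator `U ⊗ I` on `V^{⊗(k+1)}`. -/
def tensorId (U : Matrix (Fin k → Fin N) (Fin k → Fin N) α) :
    Matrix (Fin (k + 1) → Fin N) (Fin (k + 1) → Fin N) α :=
  place (shiftEmb k (k + 1) 0 (by omega)) U

theorem tensorId_one : tensorId (1 : Matrix (Fin k → Fin N) (Fin k → Fin N) α) = 1 :=
  place_one _

theorem tensorId_add (U V : Matrix (Fin k → Fin N) (Fin k → Fin N) α) :
    tensorId (U + V) = tensorId U + tensorId V :=
  place_add _ U V

theorem tensorId_smul {S : Type*} [SMulZeroClass S α] (s : S)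
    (U : Matrix (Fin k → Fin N) (Fin k → Fin N) α) : tensorId (s • U) = s • tensorId U :=
  place_smul s _ U

theorem tensorId_mul (U V : Matrix (Fin k → Fin N) (Fin k → Fin N) α) :
    tensorId (U * V) = tensorId U * tensorId V :=
  place_mul (shiftEmb_injective _ _) U V

theorem tensorId_opAt (R : Matrix (Fin N × Fin N) (Fin N × Fin N) α) {i : ℕ} (hi : i + 1 < k) :
    tensorId (opAt N k R i) = opAt N (k + 1) R i :=
  place_opAt R hi _

theorem tensorId_matAt (X : Matrix (Fin N) (Fin N) α) {i : ℕ} (hi : i < k) :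
    tensorId (matAt N k X i) = matAt N (k + 1) X i :=
  place_matAt X hi _

theorem tensorId_apply (U : Matrix (Fin k → Fin N) (Fin k → Fin N) α) (a b : Fin k → Fin N)
    (i j : Fin N) :
    tensorId U (snocIdx a i) (snocIdx b j) = if i = j then U a b else 0 := by
  classical
  have h (a : Fin k → Fin N) (i : Fin N) :
      snocIdx a i ∘ shiftEmb k (k + 1) 0 (by omega) = a :=
    funext fun l => snocIdx_of_lt a i l.2 _
  rw [tensorId, place_apply, h, h]
  refine if_congr ?_ rfl rfl
  simp only [mem_range_shiftEmb]
  rw [forall_snocIdx_eq (P := fun l => ¬ (0 ≤ l ∧ l < k + 0))]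
  simp

theorem tensorId_mul_apply (U : Matrix (Fin k → Fin N) (Fin k → Fin N) α)
    (X : Matrix (Fin (k + 1) → Fin N) (Fin (k + 1) → Fin N) α) (a : Fin k → Fin N)
    (i : Fin N) (y : Fin (k + 1) → Fin N) :
    (tensorId U * X) (snocIdx a i) y = ∑ b, U a b * X (snocIdx b i) y := by
  simp [Matrix.mul_apply, sum_snocIdx, tensorId_apply]

theorem mul_tensorId_apply (U : Matrix (Fin k → Fin N) (Fin k → Fin N) α)
    (X : Matrix (Fin (k + 1) → Fin N) (Fin (k + 1) → Fin N) α) (a : Fin k → Fin N)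
    (i : Fin N) (y : Fin (k + 1) → Fin N) :
    (X * tensorId U) y (snocIdx a i) = ∑ b, X y (snocIdx b i) * U b a := by
  simp [Matrix.mul_apply, sum_snocIdx, tensorId_apply]

theorem matAt_last_apply (X : Matrix (Fin N) (Fin N) α) (a b : Fin k → Fin N) (i j : Fin N) :
    matAt N (k + 1) X k (snocIdx a i) (snocIdx b j) = if a = b then X i j else 0 := by
  rw [matAt, dif_pos (by omega), Matrix.of_apply, snocIdx_last, snocIdx_last]
  refine if_congr ?_ rfl rfl
  rw [forall_snocIdx_eq (P := fun l => l ≠ k), funext_iff]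
  exact ⟨fun h l => h.1 l (by omega), fun h => ⟨fun l _ => h l, fun h => absurd rfl h⟩⟩

theorem opAt_last_apply (S : Matrix (Fin N × Fin N) (Fin N × Fin N) α) (a b : Fin k → Fin N)
    (i j i' j' : Fin N) :
    opAt N (k + 2) S k (snocIdx (snocIdx a i) j) (snocIdx (snocIdx b i') j') =
      if a = b then S (i, j) (i', j') else 0 := by
  rw [opAt, dif_pos (by omega), Matrix.of_apply]
  simp only [snocIdx_last, snocIdx_of_lt _ _ (Nat.lt_succ_self k)]
  refine if_congr ?_ rfl rfl
  have h (l : Fin (k + 2)) (P : Prop) :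
      ((l : ℕ) ≠ k → (l : ℕ) ≠ k + 1 → P) ↔ ((l : ℕ) ≠ k ∧ (l : ℕ) ≠ k + 1 → P) := by tauto
  simp only [h]
  rw [forall_snocIdx_eq (P := fun l => l ≠ k ∧ l ≠ k + 1),
    forall_snocIdx_eq (P := fun l => l ≠ k ∧ l ≠ k + 1), funext_iff]
  exact ⟨fun h l => h.1.1 l ⟨by omega, by omega⟩,
    fun h => ⟨⟨fun l _ => h l, fun h => absurd rfl h.1⟩, fun h => absurd rfl h.2⟩⟩

theorem opAt_last_mul_apply (S : Matrix (Fin N × Fin N) (Fin N × Fin N) α)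
    (X : Matrix (Fin (k + 2) → Fin N) (Fin (k + 2) → Fin N) α) (a : Fin k → Fin N)
    (i j : Fin N) (y : Fin (k + 2) → Fin N) :
    (opAt N (k + 2) S k * X) (snocIdx (snocIdx a i) j) y =
      ∑ i', ∑ j', S (i, j) (i', j') * X (snocIdx (snocIdx a i') j') y := by
  simp only [Matrix.mul_apply, sum_snocIdx, opAt_last_apply, ite_mul, zero_mul]
  rw [Finset.sum_eq_single a (fun b _ hb => by simp [hb.symm]) (by simp)]
  simp

theorem mul_opAt_last_apply (S : Matrix (Fin N × Fin N) (Fin N × Fin N) α)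
    (X : Matrix (Fin (k + 2) → Fin N) (Fin (k + 2) → Fin N) α) (a : Fin k → Fin N)
    (i j : Fin N) (y : Fin (k + 2) → Fin N) :
    (X * opAt N (k + 2) S k) y (snocIdx (snocIdx a i) j) =
      ∑ i', ∑ j', X y (snocIdx (snocIdx a i') j') * S (i', j') (i, j) := by
  simp only [Matrix.mul_apply, sum_snocIdx, opAt_last_apply, mul_ite, mul_zero]
  rw [Finset.sum_eq_single a (fun b _ hb => by simp [hb]) (by simp)]
  simp

end Semiring

variable {A : Type*} [Ring A] [Algebra ℂ A]

/-- The partial trace `Tr_{k+1}(C_{k+1} X)` over the last tensor factor. -/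
def partialTr (C : Matrix (Fin N) (Fin N) ℂ)
    (X : Matrix (Fin (k + 1) → Fin N) (Fin (k + 1) → Fin N) A) :
    Matrix (Fin k → Fin N) (Fin k → Fin N) A :=
  Matrix.of fun a b => ∑ c, ∑ d, C c d • X (snocIdx a d) (snocIdx b c)

theorem partialTr_apply (C : Matrix (Fin N) (Fin N) ℂ)
    (X : Matrix (Fin (k + 1) → Fin N) (Fin (k + 1) → Fin N) A) (a b : Fin k → Fin N) :
    partialTr C X a b = ∑ c, ∑ d, C c d • X (snocIdx a d) (snocIdx b c) :=
  rfl

theorem partialTr_tensorId_mul (C : Matrix (Fin N) (Fin N) ℂ)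
    (U : Matrix (Fin k → Fin N) (Fin k → Fin N) A)
    (X : Matrix (Fin (k + 1) → Fin N) (Fin (k + 1) → Fin N) A) :
    partialTr C (tensorId U * X) = U * partialTr C X := by
  ext a b
  simp only [partialTr_apply, tensorId_mul_apply]
  simp only [partialTr_apply, Matrix.mul_apply, Finset.smul_sum, Finset.mul_sum, mul_smul_comm]
  conv_rhs => rw [Finset.sum_comm]
  refine Finset.sum_congr rfl fun c _ => ?_
  rw [Finset.sum_comm]

theorem partialTr_mul_tensorId (C : Matrix (Fin N) (Fin N) ℂ)
    (U : Matrix (Fin k → Fin N) (Fin k → Fin N) A)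
    (X : Matrix (Fin (k + 1) → Fin N) (Fin (k + 1) → Fin N) A) :
    partialTr C (X * tensorId U) = partialTr C X * U := by
  ext a b
  simp only [partialTr_apply, mul_tensorId_apply]
  simp only [partialTr_apply, Matrix.mul_apply, Finset.smul_sum, Finset.sum_mul, smul_mul_assoc]
  conv_rhs => rw [Finset.sum_comm]
  refine Finset.sum_congr rfl fun c _ => ?_
  rw [Finset.sum_comm]

theorem partialTr_conj_apply (C : Matrix (Fin N) (Fin N) ℂ)
    (S T : Matrix (Fin N × Fin N) (Fin N × Fin N) A)
    (X : Matrix (Fin (k + 1) → Fin N) (Fin (k + 1) → Fin N) A) (a b : Fin k → Fin N)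
    (i j : Fin N) :
    partialTr C (opAt N (k + 2) S k * tensorId X * opAt N (k + 2) T k)
        (snocIdx a i) (snocIdx b j) =
      ∑ c, ∑ d, ∑ j', ∑ l, ∑ i', C c d •
        (S (i, d) (i', l) * X (snocIdx a i') (snocIdx b j') * T (j', l) (j, c)) := by
  simp only [partialTr_apply, mul_opAt_last_apply, opAt_last_mul_apply, tensorId_apply,
    mul_ite, mul_zero, Finset.sum_ite_eq', Finset.mem_univ, if_true, Finset.smul_sum,
    Finset.sum_mul]

theorem sum_comm_five {ι β : Type*} [Fintype ι] [AddCommMonoid β]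
    (F : ι → ι → ι → ι → ι → β) :
    ∑ c, ∑ d, ∑ j, ∑ l, ∑ i, F c d j l i = ∑ i, ∑ j, ∑ c, ∑ d, ∑ l, F c d j l i := by
  let e : ι × ι × ι × ι × ι ≃ ι × ι × ι × ι × ι :=
    { toFun := fun x => (x.2.2.2.2, x.2.2.1, x.1, x.2.1, x.2.2.2.1)
      invFun := fun x => (x.2.2.1, x.2.2.2.1, x.2.1, x.2.2.2.2, x.1) }
  have := Fintype.sum_equiv e (fun x => F x.1 x.2.1 x.2.2.1 x.2.2.2.1 x.2.2.2.2)
    (fun x => F x.2.2.1 x.2.2.2.1 x.2.1 x.2.2.2.2 x.1) fun _ => rfl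
  simpa only [Fintype.sum_prod_type] using this

theorem partialTr_conj {C : Matrix (Fin N) (Fin N) ℂ}
    {S T : Matrix (Fin N × Fin N) (Fin N × Fin N) ℂ}
    (h : ∀ i j i' j', ∑ c, ∑ d, ∑ l, C c d * (S (i, d) (i', l) * T (j', l) (j, c)) =
      if i = j then C j' i' else 0)
    (X : Matrix (Fin (k + 1) → Fin N) (Fin (k + 1) → Fin N) A) :
    partialTr C (opAt N (k + 2) (toA A S) k * tensorId X * opAt N (k + 2) (toA A T) k) =
      tensorId (partialTr C X) := by
  ext x y
  obtain ⟨a, i, rfl⟩ := exists_eq_snocIdx x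
  obtain ⟨b, j, rfl⟩ := exists_eq_snocIdx y
  have hs (s t u : ℂ) (z : A) :
      u • (algebraMap ℂ A s * z * algebraMap ℂ A t) = (u * (s * t)) • z := by
    rw [← Algebra.commutes, ← mul_assoc, ← map_mul, ← Algebra.smul_def, smul_smul, mul_comm t]
  simp only [partialTr_conj_apply, toA, Matrix.map_apply, hs]
  rw [sum_comm_five]
  simp only [← Finset.sum_smul, h, tensorId_apply, partialTr_apply]
  split_ifs
  · exact Finset.sum_comm
  · simp

theorem qTr_succ (C : Matrix (Fin N) (Fin N) ℂ)
    (X : Matrix (Fin (k + 1) → Fin N) (Fin (k + 1) → Fin N) A) :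
    qTr N (k + 1) (toA A C) X = qTr N k (toA A C) (partialTr C X) := by
  have hP : ((List.range k).map (matAt N (k + 1) (toA A C))).prod =
      tensorId ((List.range k).map (matAt N k (toA A C))).prod := by
    have : ∀ m ≤ k, ((List.range m).map (matAt N (k + 1) (toA A C))).prod =
        tensorId ((List.range m).map (matAt N k (toA A C))).prod := by
      intro m
      induction m with
      | zero => simp [tensorId_one]
      | succ m ih =>
        intro hm
        simp only [List.range_succ, List.map_append, List.prod_append, List.map_cons,
          List.map_nil, List.prod_singleton]
        rw [tensorId_mul, ih (by omega), tensorId_matAt _ hm]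
    exact this k le_rfl
  have hl (a : Fin k → Fin N) (i : Fin N) (y : Fin (k + 1) → Fin N) :
      (matAt N (k + 1) (toA A C) k * X) (snocIdx a i) y = ∑ d, C i d • X (snocIdx a d) y := by
    simp only [Matrix.mul_apply, sum_snocIdx, matAt_last_apply, ite_mul, zero_mul]
    rw [Finset.sum_eq_single a (fun b _ hb => by simp [hb.symm]) (by simp)]
    simp [toA, Algebra.smul_def]
  rw [qTr, qTr, List.range_succ, List.map_append, List.prod_append, List.map_singleton,
    List.prod_singleton, hP, mul_assoc]
  simp only [Matrix.trace, Matrix.diag_apply, sum_snocIdx, tensorId_mul_apply, hl]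
  simp only [Matrix.mul_apply, partialTr_apply]
  refine Finset.sum_congr rfl fun a _ => ?_
  rw [Finset.sum_comm]
  simp only [Finset.mul_sum]

end PartialTrace

section SkewInverse

open Kronecker

variable {N k : ℕ} {R Rinv Ψ : Matrix (Fin N × Fin N) (Fin N × Fin N) ℂ}

theorem SkewInv.contract (hΨ : SkewInv N R Ψ) (F : Fin N → Fin N → ℂ) (s r : Fin N) :
    ∑ p', ∑ p, Ψ (r, p') (s, p) * ∑ x, ∑ y, F x y * R (p, x) (p', y) = F s r := by
  have h : ∑ p', ∑ p, Ψ (r, p') (s, p) * ∑ x, ∑ y, F x y * R (p, x) (p', y) =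
      ∑ x, ∑ y, F x y * ∑ p', ∑ p, Ψ (r, p') (s, p) * R (p, x) (p', y) := by
    simp only [Finset.mul_sum]
    let e : Fin N × Fin N × Fin N × Fin N ≃ Fin N × Fin N × Fin N × Fin N :=
      { toFun := fun z => (z.2.2.1, z.2.2.2, z.1, z.2.1)
        invFun := fun z => (z.2.2.1, z.2.2.2, z.1, z.2.1) }
    have := Fintype.sum_equiv e
      (fun z => Ψ (r, z.1) (s, z.2.1) * (F z.2.2.1 z.2.2.2 * R (z.2.1, z.2.2.1) (z.1, z.2.2.2)))
      (fun z => F z.1 z.2.1 * (Ψ (r, z.2.2.1) (s, z.2.2.2) * R (z.2.2.2, z.1) (z.2.2.1, z.2.1)))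
      fun z => mul_left_comm _ _ _
    simpa only [Fintype.sum_prod_type] using this
  rw [h]
  simp only [hΨ.2, ite_and, mul_ite, mul_one, mul_zero]
  simp

theorem SkewInv.sum_traceMat_mul (hΨ : SkewInv N R Ψ) (i j : Fin N) :
    ∑ c, ∑ d, traceMat N Ψ c d * R (i, d) (j, c) = if i = j then 1 else 0 := by
  have h : ∑ c, ∑ d, traceMat N Ψ c d * R (i, d) (j, c) =
      ∑ m, ∑ d, ∑ c, R (i, d) (j, c) * Ψ (c, m) (d, m) := by
    simp only [traceMat, Matrix.of_apply, Finset.sum_mul]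
    rw [Finset.sum_comm]
    simp only [mul_comm (R _ _)]
    conv_rhs => rw [Finset.sum_comm]
    refine Finset.sum_congr rfl fun d _ => ?_
    rw [Finset.sum_comm]
  rw [h]
  simp only [hΨ.1, ite_and]
  simp

theorem SkewInv.partialTr_opAt_last (hΨ : SkewInv N R Ψ) :
    partialTr (traceMat N Ψ) (opAt N (k + 2) R k) = 1 := by
  ext x y
  obtain ⟨a, i, rfl⟩ := exists_eq_snocIdx x
  obtain ⟨b, j, rfl⟩ := exists_eq_snocIdx y
  simp only [partialTr_apply, opAt_last_apply, Matrix.one_apply, snocIdx_inj, smul_eq_mul]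
  by_cases hab : a = b
  · simp [hab, hΨ.sum_traceMat_mul]
  · simp [hab]

/-- The component form of `Tr₂(C₂ S X₁ T) = Tr(C X) I`, obtained from its instance
`Tr₃(C₃ S₂ R₁ T₂) = I`. -/
theorem SkewInv.sum_conj (hΨ : SkewInv N R Ψ)
    {S T : Matrix (Fin N × Fin N) (Fin N × Fin N) ℂ}
    (h : partialTr (traceMat N Ψ) (opAt N 3 S 1 * tensorId (opAt N 2 R 0) * opAt N 3 T 1) = 1)
    (i j s r : Fin N) :
    ∑ c, ∑ d, ∑ l, traceMat N Ψ c d * (S (i, d) (s, l) * T (r, l) (j, c)) =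
      if i = j then traceMat N Ψ r s else 0 := by
  have key (p p' : Fin N) :
      ∑ x, ∑ y, (∑ c, ∑ d, ∑ l, traceMat N Ψ c d * (S (i, d) (x, l) * T (y, l) (j, c))) *
        R (p, x) (p', y) = if p = p' ∧ i = j then 1 else 0 := by
    have h1 := congrFun (congrFun h (snocIdx (snocIdx (k := 0) default p) i))
      (snocIdx (snocIdx default p') j)
    rw [partialTr_conj_apply (k := 1)] at h1
    simp only [opAt_last_apply (k := 0), if_true] at h1
    rw [sum_comm_five, Matrix.one_apply] at h1
    simp only [snocIdx_inj, true_and, smul_eq_mul] at h1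
    rw [← h1]
    simp only [Finset.sum_mul]
    refine Finset.sum_congr rfl fun x _ => Finset.sum_congr rfl fun y _ =>
      Finset.sum_congr rfl fun c _ => Finset.sum_congr rfl fun d _ =>
      Finset.sum_congr rfl fun l _ => by ring
  have h2 := hΨ.contract (fun x y =>
    ∑ c, ∑ d, ∑ l, traceMat N Ψ c d * (S (i, d) (x, l) * T (y, l) (j, c))) s r
  rw [← h2]
  simp only [key]
  split_ifs with hij
  · simp [hij, traceMat]
  · simp [hij]

theorem SkewInv.sum_conj_right (hΨ : SkewInv N R Ψ) (hRinv : R * Rinv = 1 ∧ Rinv * R = 1)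
    (hbraid : IsBraid N R) (i j s r : Fin N) :
    ∑ c, ∑ d, ∑ l, traceMat N Ψ c d * (R (i, d) (s, l) * Rinv (r, l) (j, c)) =
      if i = j then traceMat N Ψ r s else 0 := by
  refine hΨ.sum_conj ?_ i j s r
  have h : opAt N 3 R 1 * opAt N 3 R 0 * opAt N 3 Rinv 1 =
      tensorId (opAt N 2 Rinv 0) * opAt N 3 R 1 * tensorId (opAt N 2 R 0) := by
    rw [tensorId_opAt _ (by omega), tensorId_opAt _ (by omega)]
    calc _ = opAt N 3 Rinv 0 * (opAt N 3 R 0 * opAt N 3 R 1 * opAt N 3 R 0) *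
        opAt N 3 Rinv 1 := by
          simp only [← mul_assoc, opAt_mul_opAt_eq_one hRinv.2, one_mul]
      _ = _ := by
          rw [hbraid]
          simp only [mul_assoc, opAt_mul_opAt_eq_one hRinv.1, mul_one]
  rw [tensorId_opAt _ (by omega), h, partialTr_mul_tensorId, partialTr_tensorId_mul,
    hΨ.partialTr_opAt_last (k := 1), mul_one, opAt_mul_opAt_eq_one hRinv.2]

theorem SkewInv.sum_conj_left (hΨ : SkewInv N R Ψ) (hRinv : R * Rinv = 1 ∧ Rinv * R = 1)
    (hbraid : IsBraid N R) (i j s r : Fin N) :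
    ∑ c, ∑ d, ∑ l, traceMat N Ψ c d * (Rinv (i, d) (s, l) * R (r, l) (j, c)) =
      if i = j then traceMat N Ψ r s else 0 := by
  refine hΨ.sum_conj ?_ i j s r
  have h : opAt N 3 Rinv 1 * opAt N 3 R 0 * opAt N 3 R 1 =
      tensorId (opAt N 2 R 0) * opAt N 3 R 1 * tensorId (opAt N 2 Rinv 0) := by
    rw [tensorId_opAt _ (by omega), tensorId_opAt _ (by omega)]
    calc _ = opAt N 3 Rinv 1 * (opAt N 3 R 1 * opAt N 3 R 0 * opAt N 3 R 1) *
        opAt N 3 Rinv 0 := by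
          rw [← hbraid]
          simp only [mul_assoc, opAt_mul_opAt_eq_one hRinv.1, mul_one]
      _ = _ := by
          simp only [← mul_assoc, opAt_mul_opAt_eq_one hRinv.2, one_mul]
  rw [tensorId_opAt _ (by omega), h, partialTr_mul_tensorId, partialTr_tensorId_mul,
    hΨ.partialTr_opAt_last (k := 1), mul_one, opAt_mul_opAt_eq_one hRinv.1]

theorem SkewInv.commute_kronecker (hΨ : SkewInv N R Ψ)
    (hRinv : R * Rinv = 1 ∧ Rinv * R = 1) (hbraid : IsBraid N R) :
    Commute R (traceMat N Ψ ⊗ₖ traceMat N Ψ) := by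
  set C := traceMat N Ψ
  have h1 (u x j y : Fin N) :
      ∑ c, Rinv (u, x) (j, c) * C c y = ∑ m, C u m * Ψ (x, m) (y, j) := by
    rw [← hΨ.contract (fun y x => ∑ c, Rinv (u, x) (j, c) * C c y) y x]
    have (p p' : Fin N) : ∑ z, ∑ w, (∑ c, Rinv (u, w) (j, c) * C c z) * R (p, z) (p', w) =
        if p = j then C u p' else 0 := by
      rw [← hΨ.sum_conj_right hRinv hbraid]
      simp only [Finset.sum_mul]
      refine (Finset.sum_congr rfl fun z _ => Finset.sum_comm).trans ?_
      rw [Finset.sum_comm]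
      exact Finset.sum_congr rfl fun c _ => Finset.sum_congr rfl fun d _ =>
        Finset.sum_congr rfl fun l _ => by ring
    simp only [this]
    simp [mul_comm]
  have h2 (i x v y : Fin N) :
      ∑ d, C x d * Rinv (i, d) (v, y) = ∑ m, Ψ (x, i) (y, m) * C m v := by
    rw [← hΨ.contract (fun y x => ∑ d, C x d * Rinv (i, d) (v, y)) y x]
    have (p p' : Fin N) : ∑ z, ∑ w, (∑ d, C w d * Rinv (i, d) (v, z)) * R (p, z) (p', w) =
        if i = p' then C p v else 0 := by
      rw [← hΨ.sum_conj_left hRinv hbraid]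
      simp only [Finset.sum_mul]
      rw [Finset.sum_comm]
      refine Finset.sum_congr rfl fun c _ => ?_
      rw [Finset.sum_comm]
      exact Finset.sum_congr rfl fun d _ => Finset.sum_congr rfl fun l _ => by ring
    simp only [this]
    simp
  have h : Rinv * (C ⊗ₖ C) = (C ⊗ₖ C) * Rinv := by
    ext ⟨u, x⟩ ⟨v, y⟩
    simp only [Matrix.mul_apply, Matrix.kroneckerMap_apply, Fintype.sum_prod_type]
    have e1 : ∑ j, ∑ c, Rinv (u, x) (j, c) * (C j v * C c y) =
        ∑ j, (∑ m, C u m * Ψ (x, m) (y, j)) * C j v := by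
      simp only [← h1, Finset.sum_mul]
      exact Finset.sum_congr rfl fun j _ => Finset.sum_congr rfl fun c _ => by ring
    have e2 : ∑ i, ∑ d, C u i * C x d * Rinv (i, d) (v, y) =
        ∑ i, C u i * (∑ m, Ψ (x, i) (y, m) * C m v) := by
      simp only [← h2, Finset.mul_sum, mul_assoc]
    rw [e1, e2]
    simp only [Finset.mul_sum, Finset.sum_mul, mul_assoc]
    exact Finset.sum_comm
  calc R * (C ⊗ₖ C) = R * ((C ⊗ₖ C) * Rinv) * R := by
        rw [mul_assoc, mul_assoc, hRinv.2, mul_one]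
    _ = (C ⊗ₖ C) * R := by
        rw [← h, ← mul_assoc, hRinv.1, one_mul]

theorem opAt_kronecker (X Y : Matrix (Fin N) (Fin N) ℂ) {i : ℕ} (hi : i + 1 < k) :
    opAt N k (X ⊗ₖ Y) i = matAt N k X i * matAt N k Y (i + 1) := by
  have h1 := place_matAt (s := i) X (i := 0) (by omega) (show 1 + i ≤ k by omega)
  have h2 := place_matAt (s := i + 1) Y (i := 0) (by omega) (show 1 + (i + 1) ≤ k by omega)
  rw [zero_add] at h1 h2
  ext a b
  rw [← h1, ← h2, place_mul_place_apply, opAt, dif_pos hi, Matrix.of_apply]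
  · refine if_congr ?_ ?_ rfl
    · simp only [mem_range_shiftEmb]
      refine forall_congr' fun l => ⟨fun h h1 h2 => h (by omega) (by omega),
        fun h h1 h2 => h (by omega) (by omega)⟩
    · rw [Matrix.kroneckerMap_apply, matAt, matAt, dif_pos one_pos, Matrix.of_apply,
        dif_pos one_pos, Matrix.of_apply, if_pos (by intro l; omega), if_pos (by intro l; omega)]
      simp [shiftEmb]
  · intro x y hxy
    simp only [shiftEmb, Fin.mk.injEq] at hxy
    omega

end SkewInverse

section BraidWord

variable {N k n : ℕ}

/-- The operator `S₁S₂⋯S_m` on `V^{⊗k}`. -/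
def braidWord {α : Type*} [Semiring α] (N k : ℕ)
    (S : Matrix (Fin N × Fin N) (Fin N × Fin N) α) :
    ℕ → Matrix (Fin k → Fin N) (Fin k → Fin N) α
  | 0 => 1
  | m + 1 => braidWord N k S m * opAt N k S m

/-- The operator `S_m⋯S₂S₁` on `V^{⊗k}`. -/
def braidWordRev {α : Type*} [Semiring α] (N k : ℕ)
    (S : Matrix (Fin N × Fin N) (Fin N × Fin N) α) :
    ℕ → Matrix (Fin k → Fin N) (Fin k → Fin N) α
  | 0 => 1
  | m + 1 => opAt N k S m * braidWordRev N k S m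

/-- The copies of a two-site operator `X` transported along the tensor factors by
`X ↦ R_r X R_r⁻¹`. -/
def conjCopy {α : Type*} [Semiring α] (N k : ℕ)
    (R Rinv : Matrix (Fin N × Fin N) (Fin N × Fin N) α)
    (X : Matrix (Fin k → Fin N) (Fin k → Fin N) α) :
    ℕ → Matrix (Fin k → Fin N) (Fin k → Fin N) α
  | 0 => X
  | r + 1 => opAt N k R (r + 1) * conjCopy N k R Rinv X r * opAt N k Rinv (r + 1)

variable {A : Type*} [Ring A] [Algebra ℂ A]

/-- The iterated partial trace `Tr_{2…n+1}(C₂⋯C_{n+1} X)`. -/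
def iterTr (C : Matrix (Fin N) (Fin N) ℂ) :
    (n : ℕ) → Matrix (Fin (n + 1) → Fin N) (Fin (n + 1) → Fin N) A →
      Matrix (Fin 1 → Fin N) (Fin 1 → Fin N) A
  | 0, X => X
  | n + 1, X => iterTr C n (partialTr C X)

section Semiring

variable {α : Type*} [Semiring α]

theorem braidWord_mul_braidWordRev {S T : Matrix (Fin N × Fin N) (Fin N × Fin N) α}
    (h : S * T = 1) (m : ℕ) : braidWord N k S m * braidWordRev N k T m = 1 := by
  induction m with
  | zero => exact mul_one 1
  | succ m ih =>
    rw [braidWord, braidWordRev, mul_assoc, ← mul_assoc (opAt N k S m),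
      opAt_mul_opAt_eq_one h, one_mul, ih]

theorem tensorId_braidWord (S : Matrix (Fin N × Fin N) (Fin N × Fin N) α) {m : ℕ}
    (hm : m < k) : tensorId (braidWord N k S m) = braidWord N (k + 1) S m := by
  induction m with
  | zero => exact tensorId_one
  | succ m ih => rw [braidWord, tensorId_mul, ih (by omega), tensorId_opAt _ hm, braidWord]

theorem tensorId_braidWordRev (S : Matrix (Fin N × Fin N) (Fin N × Fin N) α) {m : ℕ}
    (hm : m < k) : tensorId (braidWordRev N k S m) = braidWordRev N (k + 1) S m := by
  induction m with
  | zero => exact tensorId_one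
  | succ m ih =>
    rw [braidWordRev, tensorId_mul, ih (by omega), tensorId_opAt _ hm, braidWordRev]

theorem tensorId_ovCopy (R Rinv : Matrix (Fin N × Fin N) (Fin N × Fin N) α)
    (X : Matrix (Fin N) (Fin N) α) {r : ℕ} (hr : r < k) :
    tensorId (ovCopy N k R Rinv X r) = ovCopy N (k + 1) R Rinv X r := by
  induction r with
  | zero => exact tensorId_matAt X hr
  | succ r ih =>
    rw [ovCopy, tensorId_mul, tensorId_mul, ih (by omega), tensorId_opAt _ hr,
      tensorId_opAt _ hr, ovCopy]

theorem tensorId_ovProd (R Rinv : Matrix (Fin N × Fin N) (Fin N × Fin N) α)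
    (X : Matrix (Fin N) (Fin N) α) {m : ℕ} (hm : m ≤ k) :
    tensorId (ovProd N k R Rinv X m) = ovProd N (k + 1) R Rinv X m := by
  induction m with
  | zero => exact tensorId_one
  | succ m ih =>
    unfold ovProd at ih ⊢
    simp only [List.range_succ, List.map_append, List.prod_append, List.map_singleton,
      List.prod_singleton]
    rw [tensorId_mul, ih (by omega), tensorId_ovCopy _ _ _ hm]

end Semiring

theorem semiconjBy_list_prod {ι β : Type*} [Monoid β] (a : β) (x y : ι → β) (l : List ι)
    (h : ∀ i ∈ l, SemiconjBy a (x i) (y i)) :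
    SemiconjBy a (l.map x).prod (l.map y).prod := by
  induction l with
  | nil => exact SemiconjBy.one_right a
  | cons i l ih =>
    simp only [List.map_cons, List.prod_cons]
    exact (h i (by simp)).mul_right (ih fun j hj => h j (by simp [hj]))

theorem iterTr_matAt_mul (C : Matrix (Fin N) (Fin N) ℂ) (M : Matrix (Fin N) (Fin N) A) (n : ℕ)
    (X : Matrix (Fin (n + 1) → Fin N) (Fin (n + 1) → Fin N) A) :
    iterTr C n (matAt N (n + 1) M 0 * X) = matAt N 1 M 0 * iterTr C n X := by
  induction n with
  | zero => rfl
  | succ n ih =>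
    rw [iterTr, ← tensorId_matAt M n.succ_pos, partialTr_tensorId_mul, ih, iterTr]

theorem iterTr_mul_matAt (C : Matrix (Fin N) (Fin N) ℂ) (M : Matrix (Fin N) (Fin N) A) (n : ℕ)
    (X : Matrix (Fin (n + 1) → Fin N) (Fin (n + 1) → Fin N) A) :
    iterTr C n (X * matAt N (n + 1) M 0) = iterTr C n X * matAt N 1 M 0 := by
  induction n with
  | zero => rfl
  | succ n ih =>
    rw [iterTr, ← tensorId_matAt M n.succ_pos, partialTr_mul_tensorId, ih, iterTr]

theorem iterTr_conj {C : Matrix (Fin N) (Fin N) ℂ}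
    {S T : Matrix (Fin N × Fin N) (Fin N × Fin N) ℂ}
    (h : ∀ i j i' j', ∑ c, ∑ d, ∑ l, C c d * (S (i, d) (i', l) * T (j', l) (j, c)) =
      if i = j then C j' i' else 0)
    (n : ℕ) (X : Matrix (Fin n → Fin N) (Fin n → Fin N) A) :
    iterTr C n (braidWord N (n + 1) (toA A S) n * tensorId X *
        braidWordRev N (n + 1) (toA A T) n) =
      Matrix.diagonal fun _ => qTr N n (toA A C) X := by
  induction n with
  | zero =>
    ext x y
    obtain ⟨a, i, rfl⟩ := exists_eq_snocIdx x
    obtain ⟨b, j, rfl⟩ := exists_eq_snocIdx y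
    rw [iterTr, braidWord, braidWordRev, one_mul, mul_one, tensorId_apply,
      Matrix.diagonal_apply]
    simp only [snocIdx_inj, Subsingleton.elim a b, true_and]
    refine if_congr Iff.rfl ?_ rfl
    simp [qTr, Matrix.trace, Subsingleton.elim b default]
  | succ n ih =>
    rw [iterTr, braidWord, braidWordRev, ← tensorId_braidWord _ n.lt_succ_self,
      ← tensorId_braidWordRev _ n.lt_succ_self]
    have : tensorId (braidWord N (n + 1) (toA A S) n) * opAt N (n + 1 + 1) (toA A S) n *
        tensorId X * (opAt N (n + 1 + 1) (toA A T) n *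
          tensorId (braidWordRev N (n + 1) (toA A T) n)) =
        tensorId (braidWord N (n + 1) (toA A S) n) *
          (opAt N (n + 2) (toA A S) n * tensorId X * opAt N (n + 2) (toA A T) n) *
          tensorId (braidWordRev N (n + 1) (toA A T) n) := by
      simp only [mul_assoc]
    rw [this, partialTr_mul_tensorId, partialTr_tensorId_mul, partialTr_conj h, ih, qTr_succ]

theorem semiconjBy_braidWord_opAt {S Q : Matrix (Fin N × Fin N) (Fin N × Fin N) ℂ}
    (h : ∀ i, i + 2 < k → opAt N k (toA A S) i * opAt N k (toA A S) (i + 1) *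
        opAt N k (toA A Q) i =
      opAt N k (toA A Q) (i + 1) * (opAt N k (toA A S) i * opAt N k (toA A S) (i + 1)))
    {m i : ℕ} (hm : m < k) (hi : i + 1 < m) :
    SemiconjBy (braidWord N k (toA A S) m) (opAt N k (toA A Q) i)
      (opAt N k (toA A Q) (i + 1)) := by
  have hfar : ∀ m ≤ i, Commute (braidWord N k (toA A S) m) (opAt N k (toA A Q) (i + 1)) := by
    intro m
    induction m with
    | zero => exact fun _ => Commute.one_left _
    | succ m ih =>
      exact fun hm => (ih (by omega)).mul_left (commute_opAt_opAt _ _ (by omega))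
  induction m with
  | zero => omega
  | succ m ih =>
    rcases Nat.lt_succ_iff_lt_or_eq.1 hi with h' | rfl
    · exact (ih (by omega) h').mul_left (commute_opAt_opAt _ _ (by omega))
    · rw [braidWord, braidWord, mul_assoc]
      exact SemiconjBy.mul_left (hfar i le_rfl) (h i (by omega))

theorem semiconjBy_braidWord_matAt {S T : Matrix (Fin N × Fin N) (Fin N × Fin N) ℂ}
    (hTS : T * S = 1) (M : Matrix (Fin N) (Fin N) A) (m : ℕ) :
    SemiconjBy (braidWord N k (toA A S) (m + 1)) (matAt N k M 0)
      (opAt N k (toA A S) 0 * matAt N k M 0 * opAt N k (toA A T) 0) := by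
  induction m with
  | zero =>
    rw [braidWord, braidWord, one_mul, SemiconjBy, mul_assoc, mul_assoc,
      opAt_mul_opAt_eq_one (by rw [← toA_mul, hTS, toA_one]), mul_one]
  | succ m ih =>
    rw [braidWord]
    exact ih.mul_left (commute_opAt_matAt _ _ (by omega))

theorem semiconjBy_braidWord_ovCopy {R Rinv S T : Matrix (Fin N × Fin N) (Fin N × Fin N) ℂ}
    (hTS : T * S = 1)
    (hR : ∀ i, i + 1 < n → SemiconjBy (braidWord N k (toA A S) n) (opAt N k (toA A R) i)
      (opAt N k (toA A R) (i + 1)))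
    (hRinv : ∀ i, i + 1 < n → SemiconjBy (braidWord N k (toA A S) n) (opAt N k (toA A Rinv) i)
      (opAt N k (toA A Rinv) (i + 1)))
    (M : Matrix (Fin N) (Fin N) A) {r : ℕ} (hr : r < n) :
    SemiconjBy (braidWord N k (toA A S) n) (ovCopy N k (toA A R) (toA A Rinv) M r)
      (conjCopy N k (toA A R) (toA A Rinv)
        (opAt N k (toA A S) 0 * matAt N k M 0 * opAt N k (toA A T) 0) r) := by
  induction r with
  | zero =>
    obtain ⟨m, rfl⟩ := Nat.exists_eq_succ_of_ne_zero hr.ne'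
    exact semiconjBy_braidWord_matAt hTS M m
  | succ r ih => exact ((hR r hr).mul_right (ih (by omega))).mul_right (hRinv r hr)

theorem semiconjBy_matAt_conjCopy {R Rinv : Matrix (Fin N × Fin N) (Fin N × Fin N) ℂ}
    {M : Matrix (Fin N) (Fin N) A} {X Y : Matrix (Fin k → Fin N) (Fin k → Fin N) A}
    (h : SemiconjBy (matAt N k M 0) X Y) (r : ℕ) :
    SemiconjBy (matAt N k M 0) (conjCopy N k (toA A R) (toA A Rinv) X r)
      (conjCopy N k (toA A R) (toA A Rinv) Y r) := by
  induction r with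
  | zero => exact h
  | succ r ih =>
    have hc (Q : Matrix (Fin N × Fin N) (Fin N × Fin N) ℂ) :
        SemiconjBy (matAt N k M 0) (opAt N k (toA A Q) (r + 1)) (opAt N k (toA A Q) (r + 1)) :=
      (commute_opAt_matAt Q M (by omega)).symm
    exact ((hc R).mul_right ih).mul_right (hc Rinv)

theorem IsBraid.opAt_braid {R : Matrix (Fin N × Fin N) (Fin N × Fin N) ℂ} (h : IsBraid N R)
    {i : ℕ} (hi : i + 2 < k) :
    opAt N k (toA A R) i * opAt N k (toA A R) (i + 1) * opAt N k (toA A R) i =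
      opAt N k (toA A R) (i + 1) * opAt N k (toA A R) i * opAt N k (toA A R) (i + 1) := by
  have h0 := place_opAt (s := i) R (i := 0) (by omega) (show 3 + i ≤ k by omega)
  have h1 := place_opAt (s := i) R (i := 1) (by omega) (show 3 + i ≤ k by omega)
  rw [zero_add] at h0
  rw [add_comm 1 i] at h1
  simp only [opAt_toA, ← toA_mul, ← h0, ← h1, ← place_mul (shiftEmb_injective _ _)]
  rw [h]

/-- The reflection equation in the form `M₁ (R M₁ R⁻¹) = (R⁻¹ M₁ R) M₁` on `V^{⊗k}`. -/
theorem RErel.semiconjBy {R Rinv : Matrix (Fin N × Fin N) (Fin N × Fin N) ℂ}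
    (hRinv : R * Rinv = 1 ∧ Rinv * R = 1) {M : Matrix (Fin N) (Fin N) A}
    (hM : RErel N (toA A R) M) (hk : 2 ≤ k) :
    SemiconjBy (matAt N k M 0) (opAt N k (toA A R) 0 * matAt N k M 0 * opAt N k (toA A Rinv) 0)
      (opAt N k (toA A Rinv) 0 * matAt N k M 0 * opAt N k (toA A R) 0) := by
  have h0 : place (shiftEmb 2 k 0 hk) (opAt N 2 (toA A R) 0) = opAt N k (toA A R) 0 :=
    place_opAt _ (by omega) hk
  have h1 : place (shiftEmb 2 k 0 hk) (matAt N 2 M 0) = matAt N k M 0 :=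
    place_matAt _ (by omega) hk
  have h2 := congrArg (place (shiftEmb 2 k 0 hk)) hM
  simp only [place_mul (shiftEmb_injective _ _), h0, h1] at h2
  have h3 : opAt N k (toA A R) 0 * opAt N k (toA A Rinv) 0 = 1 :=
    opAt_mul_opAt_eq_one (by rw [← toA_mul, hRinv.1, toA_one]) 0
  have h4 : opAt N k (toA A Rinv) 0 * opAt N k (toA A R) 0 = 1 :=
    opAt_mul_opAt_eq_one (by rw [← toA_mul, hRinv.2, toA_one]) 0
  generalize opAt N k (toA A R) 0 = r at *
  generalize opAt N k (toA A Rinv) 0 = r' at *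
  generalize matAt N k M 0 = x at *
  calc x * (r * x * r') = r' * (r * x * r * x) * r' := by
        simp only [← mul_assoc, h4, one_mul]
    _ = r' * x * r * x := by
        rw [h2]
        simp only [mul_assoc, h3, mul_one]

end BraidWord

section QuantumTrace

variable {A : Type*} [Ring A] [Algebra ℂ A] {N k n : ℕ}
  {R Rinv Ψ : Matrix (Fin N × Fin N) (Fin N × Fin N) ℂ}

theorem trace_toA_mul {ι : Type*} [Fintype ι] (U : Matrix ι ι ℂ) (X : Matrix ι ι A) :
    Matrix.trace (toA A U * X) = Matrix.trace (X * toA A U) := by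
  simp only [Matrix.trace, Matrix.diag_apply, Matrix.mul_apply, toA, Matrix.map_apply,
    Algebra.commutes]
  exact Finset.sum_comm

theorem SkewInv.commute_opAt_prod (hΨ : SkewInv N R Ψ)
    (hRinv : R * Rinv = 1 ∧ Rinv * R = 1) (hbraid : IsBraid N R) {i : ℕ} (hi : i + 1 < k) :
    Commute (opAt N k (toA A R) i)
      ((List.range k).map (matAt N k (toA A (traceMat N Ψ)))).prod := by
  set C := traceMat N Ψ
  have hpair : Commute (opAt N k (toA A R) i)
      (matAt N k (toA A C) i * matAt N k (toA A C) (i + 1)) := by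
    rw [matAt_toA, matAt_toA, ← toA_mul, ← opAt_kronecker _ _ hi, opAt_toA, Commute, SemiconjBy,
      ← toA_mul, ← toA_mul, ← opAt_mul, ← opAt_mul, hΨ.commute_kronecker hRinv hbraid]
  have hlow : ∀ m ≤ i, Commute (opAt N k (toA A R) i)
      ((List.range m).map (matAt N k (toA A C))).prod := by
    refine fun m hm => Commute.list_prod_right _ _ fun x hx => ?_
    obtain ⟨j, hj, rfl⟩ := List.mem_map.1 hx
    rw [List.mem_range] at hj
    exact commute_opAt_matAt _ _ (by omega)
  have hhigh : ∀ m, i + 2 ≤ m → Commute (opAt N k (toA A R) i)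
      ((List.range m).map (matAt N k (toA A C))).prod := by
    intro m hm
    induction m, hm using Nat.le_induction with
    | base =>
      simp only [List.range_succ, List.map_append, List.prod_append, List.map_singleton,
        List.prod_singleton, mul_assoc]
      exact (hlow i le_rfl).mul_right hpair
    | succ m hm ih =>
      simp only [List.range_succ, List.map_append, List.prod_append, List.map_singleton,
        List.prod_singleton]
      exact ih.mul_right (commute_opAt_matAt _ _ (by omega))
  exact hhigh k hi

theorem SkewInv.qTr_mul_comm (hΨ : SkewInv N R Ψ)
    (hRinv : R * Rinv = 1 ∧ Rinv * R = 1) (hbraid : IsBraid N R)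
    {Z : Matrix (Fin n → Fin N) (Fin n → Fin N) A}
    (hZ : Z ∈ Algebra.adjoin ℂ (genSet N n n (toA A R)))
    (X : Matrix (Fin n → Fin N) (Fin n → Fin N) A) :
    qTr N n (toA A (traceMat N Ψ)) (Z * X) = qTr N n (toA A (traceMat N Ψ)) (X * Z) := by
  induction hZ using Algebra.adjoin_induction generalizing X with
  | mem Z hZ =>
    obtain ⟨i, hi, rfl⟩ := hZ
    rw [qTr, qTr, ← mul_assoc, ← (hΨ.commute_opAt_prod hRinv hbraid hi).eq, mul_assoc,
      opAt_toA, trace_toA_mul, mul_assoc]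
  | algebraMap c => rw [Algebra.commutes]
  | add Z W _ _ hZ hW =>
    simp only [qTr, add_mul, mul_add, Matrix.trace_add] at hZ hW ⊢
    rw [hZ, hW]
  | mul Z W _ _ hZ hW => rw [mul_assoc, hZ, mul_assoc, hW, mul_assoc]

theorem exists_semiconjBy_braidWord {S S' : Matrix (Fin N × Fin N) (Fin N × Fin N) ℂ}
    (hS : ∀ i, i + 1 < n → SemiconjBy (braidWord N (n + 1) (toA A S) n)
      (opAt N (n + 1) (toA A R) i) (opAt N (n + 1) (toA A R) (i + 1)))
    (hS' : ∀ i, i + 1 < n → SemiconjBy (braidWord N (n + 1) (toA A S') n)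
      (opAt N (n + 1) (toA A R) i) (opAt N (n + 1) (toA A R) (i + 1)))
    (M : Matrix (Fin N) (Fin N) A) {Z : Matrix (Fin n → Fin N) (Fin n → Fin N) A}
    (hZ : Z ∈ Algebra.adjoin ℂ (genSet N n n (toA A R))) :
    ∃ Z', SemiconjBy (braidWord N (n + 1) (toA A S) n) (tensorId Z) Z' ∧
      SemiconjBy (braidWord N (n + 1) (toA A S') n) (tensorId Z) Z' ∧
      Commute (matAt N (n + 1) M 0) Z' := by
  induction hZ using Algebra.adjoin_induction with
  | mem Z hZ =>
    obtain ⟨i, hi, rfl⟩ := hZ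
    refine ⟨opAt N (n + 1) (toA A R) (i + 1), ?_, ?_,
      (commute_opAt_matAt _ _ (by omega)).symm⟩
    · rw [tensorId_opAt _ hi]
      exact hS i hi
    · rw [tensorId_opAt _ hi]
      exact hS' i hi
  | algebraMap c =>
    have h : tensorId (algebraMap ℂ (Matrix (Fin n → Fin N) (Fin n → Fin N) A) c) =
        algebraMap ℂ _ c := by
      rw [Algebra.algebraMap_eq_smul_one, tensorId_smul, tensorId_one,
        Algebra.algebraMap_eq_smul_one]
    rw [h]
    exact ⟨_, Algebra.commute_algebraMap_right c _, Algebra.commute_algebraMap_right c _,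
      Algebra.commute_algebraMap_right c _⟩
  | add Z W _ _ hZ hW =>
    obtain ⟨Z', h1, h2, h3⟩ := hZ
    obtain ⟨W', g1, g2, g3⟩ := hW
    rw [tensorId_add]
    exact ⟨Z' + W', h1.add_right g1, h2.add_right g2, h3.add_right g3⟩
  | mul Z W _ _ hZ hW =>
    obtain ⟨Z', h1, h2, h3⟩ := hZ
    obtain ⟨W', g1, g2, g3⟩ := hW
    rw [tensorId_mul]
    exact ⟨Z' * W', h1.mul_right g1, h2.mul_right g2, h3.mul_right g3⟩

theorem braid_conj {G : Type*} [Group G] {a b : G} (h : a * b * a = b * a * b) :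
    a * b * a⁻¹ = b⁻¹ * (a * b) ∧ a⁻¹ * b⁻¹ * a = b * (a⁻¹ * b⁻¹) ∧
      a⁻¹ * b⁻¹ * a⁻¹ = b⁻¹ * (a⁻¹ * b⁻¹) := by
  refine ⟨?_, ?_, ?_⟩
  · rw [mul_inv_eq_iff_eq_mul, mul_assoc, h]
    group
  · rw [← mul_assoc, eq_mul_inv_iff_mul_eq, mul_assoc _ a b, eq_mul_inv_iff_mul_eq]
    calc a⁻¹ * b⁻¹ * (a * b) * a = a⁻¹ * b⁻¹ * (a * b * a) := by group
      _ = b := by rw [h]; group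
  · have := congrArg (·⁻¹) h
    simpa [mul_assoc] using this

theorem IsBraid.semiconjBy_braidWord (hbraid : IsBraid N R)
    (hRinv : R * Rinv = 1 ∧ Rinv * R = 1)
    {S Q : Matrix (Fin N × Fin N) (Fin N × Fin N) ℂ} (hS : S = R ∨ S = Rinv)
    (hQ : Q = R ∨ Q = Rinv) {i : ℕ} (hi : i + 1 < n) :
    SemiconjBy (braidWord N (n + 1) (toA A S) n) (opAt N (n + 1) (toA A Q) i)
      (opAt N (n + 1) (toA A Q) (i + 1)) := by
  refine semiconjBy_braidWord_opAt (fun i hi => ?_) n.lt_succ_self hi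
  have h1 : toA A R * toA A Rinv = 1 := by rw [← toA_mul, hRinv.1, toA_one]
  have h2 : toA A Rinv * toA A R = 1 := by rw [← toA_mul, hRinv.2, toA_one]
  let u (j : ℕ) : (Matrix (Fin (n + 1) → Fin N) (Fin (n + 1) → Fin N) A)ˣ :=
    ⟨opAt N (n + 1) (toA A R) j, opAt N (n + 1) (toA A Rinv) j, opAt_mul_opAt_eq_one h1 j,
      opAt_mul_opAt_eq_one h2 j⟩
  have hu : u i * u (i + 1) * u i = u (i + 1) * u i * u (i + 1) :=
    Units.ext (hbraid.opAt_braid hi)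
  obtain ⟨e1, e2, e3⟩ := braid_conj hu
  rcases hS with rfl | rfl <;> rcases hQ with rfl | rfl
  · exact (hbraid.opAt_braid hi).trans (mul_assoc _ _ _)
  · exact congrArg Units.val e1
  · exact congrArg Units.val e2
  · exact congrArg Units.val e3

theorem SkewInv.qTr_commute (hΨ : SkewInv N R Ψ)
    (hRinv : R * Rinv = 1 ∧ Rinv * R = 1) (hbraid : IsBraid N R)
    {M : Matrix (Fin N) (Fin N) A} (hM : RErel N (toA A R) M) (hn : 1 ≤ n)
    {Z : Matrix (Fin n → Fin N) (Fin n → Fin N) A}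
    (hZ : Z ∈ Algebra.adjoin ℂ (genSet N n n (toA A R))) (i j : Fin N) :
    Commute (qTr N n (toA A (traceMat N Ψ)) (Z * ovProd N n (toA A R) (toA A Rinv) M n))
      (M i j) := by
  set X := Z * ovProd N n (toA A R) (toA A Rinv) M n with hX
  set m := matAt N (n + 1) M 0 with hm
  obtain ⟨Z', h1, h2, h3⟩ := exists_semiconjBy_braidWord (R := R)
    (fun i hi => hbraid.semiconjBy_braidWord hRinv (.inl rfl) (.inl rfl) hi)
    (fun i hi => hbraid.semiconjBy_braidWord hRinv (.inr rfl) (.inl rfl) hi) M hZ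
  have hP : tensorId (ovProd N n (toA A R) (toA A Rinv) M n) =
      ((List.range n).map (ovCopy N (n + 1) (toA A R) (toA A Rinv) M)).prod :=
    tensorId_ovProd _ _ _ le_rfl
  have hword {S T : Matrix (Fin N × Fin N) (Fin N × Fin N) ℂ} (hS : S = R ∨ S = Rinv)
      (hTS : T * S = 1) (hST : S * T = 1)
      (h : SemiconjBy (braidWord N (n + 1) (toA A S) n) (tensorId Z) Z') :
      braidWord N (n + 1) (toA A S) n * tensorId X * braidWordRev N (n + 1) (toA A T) n =
        Z' * ((List.range n).map (conjCopy N (n + 1) (toA A R) (toA A Rinv)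
          (opAt N (n + 1) (toA A S) 0 * m * opAt N (n + 1) (toA A T) 0))).prod := by
    have hsemi := h.mul_right (semiconjBy_list_prod _ _ _ (List.range n) fun r hr =>
      semiconjBy_braidWord_ovCopy hTS
        (fun i hi => hbraid.semiconjBy_braidWord hRinv hS (.inl rfl) hi)
        (fun i hi => hbraid.semiconjBy_braidWord hRinv hS (.inr rfl) hi) M
        (List.mem_range.1 hr))
    rw [hX, tensorId_mul, hP, hsemi.eq, mul_assoc,
      braidWord_mul_braidWordRev (by rw [← toA_mul, hST, toA_one]), mul_one]
  have hmove : m * (braidWord N (n + 1) (toA A R) n * tensorId X *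
        braidWordRev N (n + 1) (toA A Rinv) n) =
      braidWord N (n + 1) (toA A Rinv) n * tensorId X *
        braidWordRev N (n + 1) (toA A R) n * m := by
    rw [hword (.inl rfl) hRinv.2 hRinv.1 h1, hword (.inr rfl) hRinv.1 hRinv.2 h2]
    exact SemiconjBy.mul_right h3 (semiconjBy_list_prod _ _ _ _ fun r _ =>
      semiconjBy_matAt_conjCopy (hM.semiconjBy hRinv (by omega)) r)
  have htr := congrArg (iterTr (traceMat N Ψ) n) hmove
  rw [hm, iterTr_matAt_mul, iterTr_mul_matAt, iterTr_conj (hΨ.sum_conj_right hRinv hbraid),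
    iterTr_conj (hΨ.sum_conj_left hRinv hbraid)] at htr
  have hij := congrFun (congrFun htr fun _ => i) fun _ => j
  rw [Matrix.mul_diagonal, Matrix.diagonal_mul, matAt, dif_pos one_pos, Matrix.of_apply,
    if_pos (by intro l; omega)] at hij
  exact hij.symm

end QuantumTrace

/-- For every `n ≥ 1` and every `Z` in the unital subalgebra of
`End(V^{⊗n})` generated by `R₁, …, R_{n−1}`, the element
`ch_n(Z) = Tr_{R(1…n)}(Z · M_{⟨1→n⟩})` equals `Tr_{R(1…n)}(M_{⟨1→n⟩} · Z)` and commutes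
with every entry of `M`. -/
theorem stmt6 {A : Type*} [Ring A] [Algebra ℂ A] (N : ℕ) (hN : 1 ≤ N) (q : ℂ)
    (hq : GenericQ q)
    (R Rinv Ψ : Matrix (Fin N × Fin N) (Fin N × Fin N) ℂ)
    (hRinv : R * Rinv = 1 ∧ Rinv * R = 1)
    (hbraid : IsBraid N R) (hHecke : IsHecke N q R)
    (hΨ : SkewInv N R Ψ)
    (M : Matrix (Fin N) (Fin N) A)
    (hM : RErel N (toA A R) M)
    (n : ℕ) (hn : 1 ≤ n)
    (Z : Matrix (Fin n → Fin N) (Fin n → Fin N) A)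
    (hZ : Z ∈ Algebra.adjoin ℂ (genSet N n n (toA A R))) :
    qTr N n (toA A (traceMat N Ψ)) (Z * ovProd N n (toA A R) (toA A Rinv) M n) =
        qTr N n (toA A (traceMat N Ψ)) (ovProd N n (toA A R) (toA A Rinv) M n * Z) ∧
      ∀ i j : Fin N,
        Commute (qTr N n (toA A (traceMat N Ψ))
          (Z * ovProd N n (toA A R) (toA A Rinv) M n)) (M i j) := by
  exact ⟨hΨ.qTr_mul_comm hRinv hbraid hZ _,
    fun i j => hΨ.qTr_commute hRinv hbraid hM hn hZ i j⟩
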